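/- arXiv:gr-qc/9802058 — 5 statements merged into one kernel-verified Lean document; each statement's English description precedes it below -/
import Mathlib

section
/- Let J be a nonempty index set, n a natural number, and G : J → Matrix n n ℂ a family of Hermitian invertible complex matrices. There exists a family of matrices L : J → J → Matrix n n ℂ satisfying L(s,s) = 1, L(t,r) * L(s,t) = L(s,r) for all r,s,t ∈ J, and the compatibility condition G(s) = (L(s,t))ᴴ * G(t) * L(s,t) for all s,t ∈ J, if and only if the number of positive eigenvalues of G(s) (counted with multiplicity) is independent of s ∈ J. -/
open Matrix

/-- A matrix that transforms one real diagonal form into another by congruence cannot increase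
the positive index of inertia. -/
theorem card_pos_le_of_diagonal_eq_congr {m n : Type*} [Fintype m] [DecidableEq m]
    [Fintype n] [DecidableEq n] (M : Matrix n m ℂ) (d : m → ℝ) (e : n → ℝ)
    (h : diagonal (fun i => (d i : ℂ)) = Mᴴ * diagonal (fun i => (e i : ℂ)) * M) :
    Nat.card {i // 0 < d i} ≤ Nat.card {i // 0 < e i} := by
  classical
  have key (x : m → ℂ) :
      ∑ i, d i * Complex.normSq (x i) = ∑ i, e i * Complex.normSq ((M *ᵥ x) i) := by
    have h1 : star x ⬝ᵥ (diagonal (fun i => (d i : ℂ)) *ᵥ x) =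
        star (M *ᵥ x) ⬝ᵥ (diagonal (fun i => (e i : ℂ)) *ᵥ (M *ᵥ x)) := by
      rw [h, star_mulVec, ← dotProduct_mulVec, mulVec_mulVec, mulVec_mulVec, Matrix.mul_assoc]
    simp only [dotProduct, mulVec_diagonal, Pi.star_apply] at h1
    have h2 (a : ℝ) (z : ℂ) : star z * ((a : ℂ) * z) = ((a * Complex.normSq z : ℝ) : ℂ) := by
      push_cast
      rw [Complex.normSq_eq_conj_mul_self]
      simp only [starRingEnd_apply]
      ring
    simp only [h2] at h1
    exact_mod_cast h1
  let N : Matrix {i // 0 < e i} {i // 0 < d i} ℂ := M.submatrix (↑) (↑)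
  have hN : Function.Injective N.mulVecLin := by
    rw [← LinearMap.ker_eq_bot, LinearMap.ker_eq_bot']
    intro x hx
    let y : m → ℂ := fun i => if hi : 0 < d i then x ⟨i, hi⟩ else 0
    have hMy (j : {i // 0 < e i}) : (M *ᵥ y) j = 0 := by
      have hj : (N *ᵥ x) j = 0 := congrFun hx j
      rw [← hj]
      simp only [mulVec, dotProduct, N, submatrix_apply]
      rw [← Fintype.sum_subtype_add_sum_subtype (fun i => 0 < d i)]
      have h1 (i : {i // 0 < d i}) : y i = x i := dif_pos i.2
      have h2 (i : {i // ¬ 0 < d i}) : y i = 0 := dif_neg i.2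
      simp only [h1, h2, mul_zero, Finset.sum_const_zero, add_zero]
    have hle : ∑ i, d i * Complex.normSq (y i) ≤ 0 := by
      rw [key]
      refine Finset.sum_nonpos fun i _ => ?_
      by_cases hi : 0 < e i
      · simp [hMy ⟨i, hi⟩]
      · exact mul_nonpos_of_nonpos_of_nonneg (not_lt.mp hi) (Complex.normSq_nonneg _)
    have hnn (i : m) : 0 ≤ d i * Complex.normSq (y i) := by
      by_cases hi : 0 < d i
      · exact mul_nonneg hi.le (Complex.normSq_nonneg _)
      · simp [y, hi]
    have h0 := (Finset.sum_eq_zero_iff_of_nonneg fun i _ => hnn i).mp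
      (le_antisymm hle (Finset.sum_nonneg fun i _ => hnn i))
    funext ⟨i, hi⟩
    simpa [y, hi, hi.ne'] using h0 i (Finset.mem_univ i)
  simpa using LinearMap.finrank_le_finrank_of_injective hN

/-- Nonvanishing real diagonal forms with the same positive index are congruent. -/
theorem exists_diagonal_eq_congr {n : Type*} [Fintype n] [DecidableEq n] (d e : n → ℝ)
    (hd : ∀ i, d i ≠ 0) (he : ∀ i, e i ≠ 0)
    (h : Nat.card {i // 0 < d i} = Nat.card {i // 0 < e i}) :
    ∃ Q : Matrix n n ℂ,
      diagonal (fun i => (d i : ℂ)) = Qᴴ * diagonal (fun i => (e i : ℂ)) * Q := by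
  classical
  obtain ⟨f⟩ := (Finite.card_eq (α := {i // 0 < d i}) (β := {i // 0 < e i})).mp h
  let σ : Equiv.Perm n := f.extendSubtype
  have hσ (i : n) : 0 < d i / e (σ i) := by
    by_cases hi : 0 < d i
    · exact div_pos hi (f.extendSubtype_mem i hi)
    · exact div_pos_of_neg_of_neg (lt_of_le_of_ne (not_lt.mp hi) (hd i))
        (lt_of_le_of_ne (not_lt.mp (f.extendSubtype_not_mem i hi)) (he _))
  refine ⟨Matrix.of fun i j => if i = σ j then (Real.sqrt (d j / e (σ j)) : ℂ) else 0, ?_⟩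
  ext i j
  rw [Matrix.mul_apply]
  simp only [mul_diagonal, conjTranspose_apply, of_apply, mul_ite, mul_zero,
    Finset.sum_ite_eq', Finset.mem_univ, if_true]
  by_cases hij : i = j
  · subst hij
    have hs := Real.mul_self_sqrt (hσ i).le
    have : d i = √(d i / e (σ i)) * e (σ i) * √(d i / e (σ i)) := by
      rw [mul_right_comm, hs, div_mul_cancel₀ _ (he _)]
    simp only [diagonal_apply_eq, if_true, Complex.star_def, Complex.conj_ofReal]
    exact_mod_cast this
  · have : σ j ≠ σ i := fun h => hij (σ.injective h).symm
    simp [hij, this]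

/-- The spectral theorem as a pair of congruences with a diagonal matrix. -/
theorem Matrix.IsHermitian.exists_diagonal_congr {n : Type*} [Fintype n] [DecidableEq n]
    {A : Matrix n n ℂ} (hA : A.IsHermitian) :
    ∃ U : Matrix n n ℂ, A = Uᴴ * diagonal (fun i => (hA.eigenvalues i : ℂ)) * U ∧
      diagonal (fun i => (hA.eigenvalues i : ℂ)) = U * A * Uᴴ := by
  let U : Matrix n n ℂ := star (hA.eigenvectorUnitary : Matrix n n ℂ)
  have hAU : A = Uᴴ * diagonal (fun i => (hA.eigenvalues i : ℂ)) * U := by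
    simpa [U, star_eq_conjTranspose, Function.comp_def, Unitary.conjStarAlgAut_apply]
      using hA.spectral_theorem
  have hU : U * Uᴴ = 1 := by
    simpa [U, star_eq_conjTranspose] using Unitary.coe_star_mul_self hA.eigenvectorUnitary
  refine ⟨U, hAU, ?_⟩
  calc diagonal (fun i => (hA.eigenvalues i : ℂ))
      = (U * Uᴴ) * diagonal (fun i => (hA.eigenvalues i : ℂ)) * (U * Uᴴ) := by
        rw [hU, Matrix.one_mul, Matrix.mul_one]
    _ = U * (Uᴴ * diagonal (fun i => (hA.eigenvalues i : ℂ)) * U) * Uᴴ := by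
        simp only [Matrix.mul_assoc]
    _ = U * A * Uᴴ := by rw [← hAU]

/-- Congruence does not increase the positive index of inertia of a Hermitian matrix. -/
theorem Matrix.IsHermitian.card_pos_eigenvalues_le_of_eq_congr {m n : Type*} [Fintype m]
    [DecidableEq m] [Fintype n] [DecidableEq n] {A : Matrix m m ℂ} {B : Matrix n n ℂ}
    (hA : A.IsHermitian) (hB : B.IsHermitian) (M : Matrix n m ℂ) (h : A = Mᴴ * B * M) :
    Nat.card {i // 0 < hA.eigenvalues i} ≤ Nat.card {i // 0 < hB.eigenvalues i} := by
  obtain ⟨U, -, hU⟩ := hA.exists_diagonal_congr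
  obtain ⟨V, hV, -⟩ := hB.exists_diagonal_congr
  refine card_pos_le_of_diagonal_eq_congr (V * M * Uᴴ) _ _ ?_
  rw [hU, h]
  conv_lhs => rw [hV]
  simp only [conjTranspose_mul, conjTranspose_conjTranspose, Matrix.mul_assoc]

/-- Invertible Hermitian matrices with the same positive index of inertia are congruent. -/
theorem Matrix.IsHermitian.exists_eq_congr_of_card_pos_eigenvalues_eq {n : Type*} [Fintype n]
    [DecidableEq n] {A B : Matrix n n ℂ} (hA : A.IsHermitian) (hB : B.IsHermitian)
    (hAu : IsUnit A) (hBu : IsUnit B)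
    (h : Nat.card {i // 0 < hA.eigenvalues i} = Nat.card {i // 0 < hB.eigenvalues i}) :
    ∃ P : Matrix n n ℂ, A = Pᴴ * B * P := by
  have eigenvalues_ne {C : Matrix n n ℂ} (hC : C.IsHermitian) (hCu : IsUnit C) (i : n) :
      hC.eigenvalues i ≠ 0 := by
    have hdet := ((Matrix.isUnit_iff_isUnit_det C).mp hCu).ne_zero
    rw [hC.det_eq_prod_eigenvalues] at hdet
    exact fun h0 => Finset.prod_ne_zero_iff.mp hdet i (Finset.mem_univ i) (by simp [h0])
  obtain ⟨U, hU, -⟩ := hA.exists_diagonal_congr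
  obtain ⟨V, -, hV⟩ := hB.exists_diagonal_congr
  obtain ⟨Q, hQ⟩ := exists_diagonal_eq_congr _ _ (eigenvalues_ne hA hAu)
    (eigenvalues_ne hB hBu) h
  refine ⟨Vᴴ * Q * U, ?_⟩
  conv_lhs => rw [hU, hQ, hV]
  simp only [conjTranspose_mul, conjTranspose_conjTranspose, Matrix.mul_assoc]

/-- For a family of Hermitian invertible complex matrices `G s`, a transport
family `L` compatible with `G` exists iff the number of positive eigenvalues of `G s`
(counted with multiplicity) is independent of `s`. -/
theorem compatible_transport_exists_iff_positive_index_constant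
    {J : Type*} [Nonempty J] {n : ℕ}
    (G : J → Matrix (Fin n) (Fin n) ℂ)
    (hG : ∀ s, (G s).IsHermitian)
    (hGu : ∀ s, IsUnit (G s)) :
    (∃ L : J → J → Matrix (Fin n) (Fin n) ℂ,
        (∀ s, L s s = 1) ∧
        (∀ r s t, L t r * L s t = L s r) ∧
        (∀ s t, G s = (L s t)ᴴ * G t * L s t)) ↔
      ∀ s t : J,
        Nat.card {i : Fin n // 0 < (hG s).eigenvalues i} =
          Nat.card {i : Fin n // 0 < (hG t).eigenvalues i} := by
  constructor
  · rintro ⟨L, -, -, hL⟩ s t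
    exact le_antisymm ((hG s).card_pos_eigenvalues_le_of_eq_congr (hG t) _ (hL s t))
      ((hG t).card_pos_eigenvalues_le_of_eq_congr (hG s) _ (hL t s))
  · intro h
    obtain ⟨s₀⟩ := ‹Nonempty J›
    choose P hP using fun s => (hG s).exists_eq_congr_of_card_pos_eigenvalues_eq (hG s₀)
      (hGu s) (hGu s₀) (h s s₀)
    have hPu (s : J) : IsUnit (P s).det := by
      have hdet := (Matrix.isUnit_iff_isUnit_det _).mp (hGu s)
      rw [hP s, det_mul] at hdet
      exact isUnit_of_mul_isUnit_right hdet
    have hcancel (s t : J) : P t * ((P t)⁻¹ * P s) = P s :=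
      Matrix.mul_nonsing_inv_cancel_left _ _ (hPu t)
    refine ⟨fun s t => (P t)⁻¹ * P s, fun s => Matrix.nonsing_inv_mul _ (hPu s),
      fun r s t => ?_, fun s t => ?_⟩
    · simp only [Matrix.mul_assoc, hcancel]
    · rw [hP t]
      calc G s = (P t * ((P t)⁻¹ * P s))ᴴ * G s₀ * (P t * ((P t)⁻¹ * P s)) := by
            rw [hcancel, ← hP s]
        _ = _ := by
            rw [conjTranspose_mul (P t)]
            simp only [Matrix.mul_assoc]
end

section
/- Let J be a nonempty index set, n a natural number, and G : J → Matrix n n ℂ a family of Hermitian complex matrices (possibly singular). There exists a family of invertible matrices L : J → J → Matrix n n ℂ satisfying L(s,s) = 1, L(t,r) * L(s,t) = L(s,r) for all r,s,t ∈ J, and G(s) = (L(s,t))ᴴ * G(t) * L(s,t) for all s,t ∈ J, if and only if both the number of positive eigenvalues and the number of negative eigenvalues of G(s) (counted with multiplicity) are independent of s ∈ J. -/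
open Matrix

/-- The Hermitian form of a real diagonal matrix is a weighted sum of squared moduli. -/
theorem Matrix.star_dotProduct_diagonal_mulVec {m : Type*} [Fintype m] [DecidableEq m]
    (c : m → ℝ) (y : m → ℂ) :
    star y ⬝ᵥ (diagonal (fun i ↦ (c i : ℂ)) *ᵥ y) =
      ((∑ i, c i * Complex.normSq (y i) : ℝ) : ℂ) := by
  simp only [dotProduct, mulVec_diagonal, Pi.star_apply, Complex.ofReal_sum,
    Complex.ofReal_mul, Complex.normSq_eq_conj_mul_self, Complex.star_def]
  exact Finset.sum_congr rfl fun i _ ↦ by ring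

/-- A diagonal real matrix pulled back from another one along a (rectangular) matrix has at most as
many positive entries. -/
theorem Matrix.card_pos_le_of_diagonal_eq_conjTranspose_mul_mul
    {m n : Type*} [Fintype m] [Fintype n] [DecidableEq m] [DecidableEq n]
    {a : m → ℝ} {b : n → ℝ} {P : Matrix n m ℂ}
    (h : diagonal (fun i ↦ (a i : ℂ)) = Pᴴ * diagonal (fun i ↦ (b i : ℂ)) * P) :
    Nat.card {i // 0 < a i} ≤ Nat.card {i // 0 < b i} := by
  have quad (x : m → ℂ) :
      ∑ i, a i * Complex.normSq (x i) = ∑ j, b j * Complex.normSq ((P *ᵥ x) j) := by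
    have key : star x ⬝ᵥ (diagonal (fun i ↦ (a i : ℂ)) *ᵥ x) =
        star (P *ᵥ x) ⬝ᵥ (diagonal (fun i ↦ (b i : ℂ)) *ᵥ (P *ᵥ x)) := by
      rw [h, star_mulVec, ← dotProduct_mulVec, mulVec_mulVec, mulVec_mulVec, Matrix.mul_assoc]
    simpa only [star_dotProduct_diagonal_mulVec, Complex.ofReal_inj] using key
  let f : ({i // 0 < a i} → ℂ) →ₗ[ℂ] ({i // 0 < b i} → ℂ) :=
    LinearMap.funLeft ℂ ℂ Subtype.val ∘ₗ P.mulVecLin ∘ₗ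
      Function.ExtendByZero.linearMap ℂ (Subtype.val : {i // 0 < a i} → m)
  have hf : Function.Injective f := by
    refine (injective_iff_map_eq_zero f).2 fun x hx ↦ ?_
    let y : m → ℂ := Function.extend Subtype.val x 0
    have hyx (i : {i // 0 < a i}) : y i = x i := Subtype.val_injective.extend_apply x 0 i
    have hy0 (i : m) (hi : ¬ 0 < a i) : y i = 0 :=
      Function.extend_apply' x (0 : m → ℂ) i fun ⟨j, hj⟩ ↦ hi (hj ▸ j.2)
    have hPy (j : n) (hj : 0 < b j) : (P *ᵥ y) j = 0 := congrFun hx ⟨j, hj⟩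
    have hnonneg (i : m) : 0 ≤ a i * Complex.normSq (y i) := by
      by_cases hi : 0 < a i
      · exact mul_nonneg hi.le (Complex.normSq_nonneg _)
      · simp [hy0 i hi]
    have hnonpos (j : n) : b j * Complex.normSq ((P *ᵥ y) j) ≤ 0 := by
      by_cases hj : 0 < b j
      · simp [hPy j hj]
      · exact mul_nonpos_of_nonpos_of_nonneg (not_lt.1 hj) (Complex.normSq_nonneg _)
    have hsum : ∑ i, a i * Complex.normSq (y i) = 0 :=
      le_antisymm (quad y ▸ Finset.sum_nonpos fun j _ ↦ hnonpos j)
        (Finset.sum_nonneg fun i _ ↦ hnonneg i)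
    ext i
    have hi := (Finset.sum_eq_zero_iff_of_nonneg fun i _ ↦ hnonneg i).1 hsum i (Finset.mem_univ _)
    rw [hyx] at hi
    simpa using (mul_eq_zero.1 hi).resolve_left i.2.ne'
  simpa using LinearMap.finrank_le_finrank_of_injective hf

/-- Sylvester's law of inertia for real diagonal matrices, the necessity part: congruent diagonal
matrices have equally many positive and equally many negative entries. -/
theorem Matrix.card_eq_of_diagonal_eq_conjTranspose_mul_mul
    {n : Type*} [Fintype n] [DecidableEq n] {a b : n → ℝ} {P : Matrix n n ℂ} (hP : IsUnit P)
    (h : diagonal (fun i ↦ (a i : ℂ)) = Pᴴ * diagonal (fun i ↦ (b i : ℂ)) * P) :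
    Nat.card {i // 0 < a i} = Nat.card {i // 0 < b i} ∧
      Nat.card {i // a i < 0} = Nat.card {i // b i < 0} := by
  have hdet := (isUnit_iff_isUnit_det P).1 hP
  have hinv : diagonal (fun i ↦ (b i : ℂ)) = P⁻¹ᴴ * diagonal (fun i ↦ (a i : ℂ)) * P⁻¹ := by
    have hc : P⁻¹ᴴ * Pᴴ = 1 := by
      rw [← conjTranspose_mul, mul_nonsing_inv _ hdet, conjTranspose_one]
    rw [h, Matrix.mul_assoc, mul_nonsing_inv_cancel_right _ _ hdet, ← Matrix.mul_assoc, hc,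
      Matrix.one_mul]
  have neg {c d : n → ℝ} {Q : Matrix n n ℂ}
      (hQ : diagonal (fun i ↦ (c i : ℂ)) = Qᴴ * diagonal (fun i ↦ (d i : ℂ)) * Q) :
      Nat.card {i // c i < 0} ≤ Nat.card {i // d i < 0} := by
    have hneg : diagonal (fun i ↦ ((-c i : ℝ) : ℂ)) =
        Qᴴ * diagonal (fun i ↦ ((-d i : ℝ) : ℂ)) * Q := by
      simp only [Complex.ofReal_neg, ← diagonal_neg, Matrix.mul_neg, Matrix.neg_mul, hQ]
    simpa only [neg_pos] using card_pos_le_of_diagonal_eq_conjTranspose_mul_mul hneg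
  exact ⟨le_antisymm (card_pos_le_of_diagonal_eq_conjTranspose_mul_mul h)
    (card_pos_le_of_diagonal_eq_conjTranspose_mul_mul hinv), le_antisymm (neg h) (neg hinv)⟩

/-- Two real families on the same finite type with equally many positive and equally many negative
entries have the same signs up to a permutation. -/
theorem exists_equiv_sign_eq {n : Type*} [Finite n] {a b : n → ℝ}
    (hpos : Nat.card {i // 0 < a i} = Nat.card {i // 0 < b i})
    (hneg : Nat.card {i // a i < 0} = Nat.card {i // b i < 0}) :
    ∃ e : n ≃ n, ∀ i, SignType.sign (b (e i)) = SignType.sign (a i) := by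
  classical
  have := Fintype.ofFinite n
  have hzero (d : n → ℝ) : Nat.card {i // 0 < d i} + Nat.card {i // d i < 0} +
      Nat.card {i // d i = 0} = Nat.card n := by
    simp only [Nat.card_eq_fintype_card, Fintype.card_subtype]
    rw [← Finset.card_union_of_disjoint, ← Finset.card_union_of_disjoint, ← Finset.card_univ]
    · congr 1
      ext i
      rcases lt_trichotomy (d i) 0 with h | h | h <;> simp [h]
    all_goals
      rw [Finset.disjoint_left]
      grind
  have hfiber (c : SignType) : Nonempty
      ({i // SignType.sign (a i) = c} ≃ {i // SignType.sign (b i) = c}) := by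
    refine Finite.card_eq.1 ?_
    have ha := hzero a
    have hb := hzero b
    rcases c with _ | _ | _
    · simp only [SignType.zero_eq_zero, sign_eq_zero_iff]
      omega
    · simpa only [SignType.neg_eq_neg_one, sign_eq_neg_one_iff] using hneg
    · simpa only [SignType.pos_eq_one, sign_eq_one_iff] using hpos
  exact ⟨Equiv.ofFiberEquiv fun c ↦ (hfiber c).some,
    fun i ↦ Equiv.ofFiberEquiv_map (g := fun i ↦ SignType.sign (b i)) _ i⟩

/-- Sylvester's law of inertia for real diagonal matrices, the sufficiency part: diagonal matrices
with equally many positive and equally many negative entries are congruent. -/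
theorem Matrix.exists_isUnit_diagonal_eq_conjTranspose_mul_mul
    {n : Type*} [Fintype n] [DecidableEq n] {a b : n → ℝ}
    (hpos : Nat.card {i // 0 < a i} = Nat.card {i // 0 < b i})
    (hneg : Nat.card {i // a i < 0} = Nat.card {i // b i < 0}) :
    ∃ P : Matrix n n ℂ, IsUnit P ∧
      diagonal (fun i ↦ (a i : ℂ)) = Pᴴ * diagonal (fun i ↦ (b i : ℂ)) * P := by
  obtain ⟨e, he⟩ := exists_equiv_sign_eq hpos hneg
  have hscale (i : n) : ∃ c : ℝ, c ≠ 0 ∧ a i = c * b (e i) * c := by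
    rcases eq_or_ne (a i) 0 with h | h
    · have hb : b (e i) = 0 := by simpa [h] using he i
      exact ⟨1, one_ne_zero, by simp [h, hb]⟩
    · have hb : b (e i) ≠ 0 := by
        intro hb
        have := he i
        rw [hb, sign_zero, eq_comm, sign_eq_zero_iff] at this
        exact h this
      have hdiv : 0 < a i / b (e i) := by
        rw [← sign_eq_one_iff, div_eq_mul_inv, sign_mul]
        rcases hb.lt_or_gt with h' | h'
        · have := he i
          rw [sign_neg h'] at this
          simp [← this, sign_neg (inv_lt_zero.2 h')]
        · have := he i
          rw [sign_pos h'] at this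
          simp [← this, sign_pos (inv_pos.2 h')]
      refine ⟨√(a i / b (e i)), (Real.sqrt_pos.2 hdiv).ne', ?_⟩
      rw [mul_right_comm, Real.mul_self_sqrt hdiv.le, div_mul_cancel₀ _ hb]
  choose c hc0 hc using hscale
  refine ⟨(1 : Matrix n n ℂ).submatrix id e * diagonal (fun i ↦ (c i : ℂ)), ?_, ?_⟩
  · refine IsUnit.mul ?_ ?_
    · exact (isUnit_submatrix_equiv (Equiv.refl n) e).2 isUnit_one
    · simpa [isUnit_iff_isUnit_det, Finset.prod_ne_zero_iff] using hc0
  · have hperm : ((1 : Matrix n n ℂ).submatrix id e)ᴴ * diagonal (fun i ↦ (b i : ℂ)) *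
        (1 : Matrix n n ℂ).submatrix id e = diagonal (fun i ↦ (b (e i) : ℂ)) := by
      ext i j
      obtain rfl | h := eq_or_ne i j <;> simp [mul_apply, one_apply, diagonal_apply, *]
    calc diagonal (fun i ↦ (a i : ℂ))
        = (diagonal (fun i ↦ (c i : ℂ)))ᴴ * diagonal (fun i ↦ (b (e i) : ℂ)) *
            diagonal (fun i ↦ (c i : ℂ)) := by
          rw [diagonal_conjTranspose, diagonal_mul_diagonal, diagonal_mul_diagonal]
          exact congrArg diagonal (funext fun i ↦ by simp [hc i])
      _ = _ := by simp only [← hperm, conjTranspose_mul, Matrix.mul_assoc]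

/-- A Hermitian matrix is unitarily congruent to the diagonal matrix of its eigenvalues. -/
theorem Matrix.IsHermitian.exists_unitary_congr_diagonal_eigenvalues
    {n : Type*} [Fintype n] [DecidableEq n] {A : Matrix n n ℂ} (hA : A.IsHermitian) :
    ∃ U : Matrix n n ℂ, U * Uᴴ = 1 ∧ Uᴴ * U = 1 ∧
      A = Uᴴ * diagonal (fun i ↦ (hA.eigenvalues i : ℂ)) * U := by
  refine ⟨(star hA.eigenvectorUnitary : unitaryGroup n ℂ), ?_, ?_, ?_⟩
  · exact Unitary.mul_star_self_of_mem (star hA.eigenvectorUnitary).2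
  · exact Unitary.star_mul_self_of_mem (star hA.eigenvectorUnitary).2
  · conv_lhs => rw [hA.spectral_theorem, Unitary.conjStarAlgAut_apply]
    simp [star_eq_conjTranspose, Function.comp_def]

/-- Sylvester's law of inertia for complex Hermitian matrices: two such matrices are congruent if
and only if they have equally many positive and equally many negative eigenvalues. -/
theorem Matrix.IsHermitian.exists_congr_iff_card_eigenvalues_eq
    {n : Type*} [Fintype n] [DecidableEq n] {A B : Matrix n n ℂ}
    (hA : A.IsHermitian) (hB : B.IsHermitian) :
    (∃ P : Matrix n n ℂ, IsUnit P ∧ A = Pᴴ * B * P) ↔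
      Nat.card {i // 0 < hA.eigenvalues i} = Nat.card {i // 0 < hB.eigenvalues i} ∧
        Nat.card {i // hA.eigenvalues i < 0} = Nat.card {i // hB.eigenvalues i < 0} := by
  obtain ⟨U, hU, hU', hAU⟩ := hA.exists_unitary_congr_diagonal_eigenvalues
  obtain ⟨V, hV, hV', hBV⟩ := hB.exists_unitary_congr_diagonal_eigenvalues
  generalize hA.eigenvalues = a at *
  generalize hB.eigenvalues = b at *
  subst hAU hBV
  constructor
  · rintro ⟨P, hP, h⟩
    have hdiag : diagonal (fun i ↦ (a i : ℂ)) =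
        (V * P * Uᴴ)ᴴ * diagonal (fun i ↦ (b i : ℂ)) * (V * P * Uᴴ) := by
      calc _ = (U * Uᴴ) * diagonal (fun i ↦ (a i : ℂ)) * (U * Uᴴ) := by
            rw [hU, Matrix.one_mul, Matrix.mul_one]
        _ = U * (Uᴴ * diagonal (fun i ↦ (a i : ℂ)) * U) * Uᴴ := by simp only [Matrix.mul_assoc]
        _ = _ := by
          rw [h]
          simp only [conjTranspose_mul, conjTranspose_conjTranspose, Matrix.mul_assoc]
    exact card_eq_of_diagonal_eq_conjTranspose_mul_mul
      (((IsUnit.of_mul_eq_one _ hV).mul hP).mul (IsUnit.of_mul_eq_one _ hU')) hdiag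
  · rintro ⟨hpos, hneg⟩
    obtain ⟨Q, hQ, h⟩ := exists_isUnit_diagonal_eq_conjTranspose_mul_mul hpos hneg
    refine ⟨Vᴴ * Q * U, ((IsUnit.of_mul_eq_one _ hV').mul hQ).mul (IsUnit.of_mul_eq_one _ hU), ?_⟩
    calc _ = Uᴴ * (Qᴴ * diagonal (fun i ↦ (b i : ℂ)) * Q) * U := by rw [h]
      _ = Uᴴ * Qᴴ * (V * Vᴴ) * diagonal (fun i ↦ (b i : ℂ)) * (V * Vᴴ) * Q * U := by
        simp only [hV, Matrix.mul_one, Matrix.mul_assoc]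
      _ = _ := by
        simp only [conjTranspose_mul, conjTranspose_conjTranspose, Matrix.mul_assoc]

/-- For a family of Hermitian (possibly singular) complex matrices `G s`,
an invertible transport family `L` compatible with `G` exists iff the numbers of positive
and of negative eigenvalues of `G s` (with multiplicity) are independent of `s`. -/
theorem compatible_transport_exists_iff_inertia_constant_complex
    {J : Type*} [Nonempty J] {n : ℕ}
    (G : J → Matrix (Fin n) (Fin n) ℂ)
    (hG : ∀ s, (G s).IsHermitian) :
    (∃ L : J → J → Matrix (Fin n) (Fin n) ℂ,
        (∀ s, L s s = 1) ∧
        (∀ r s t, L t r * L s t = L s r) ∧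
        (∀ s t, IsUnit (L s t)) ∧
        (∀ s t, G s = (L s t)ᴴ * G t * L s t)) ↔
      ∀ s t : J,
        Nat.card {i : Fin n // 0 < (hG s).eigenvalues i} =
            Nat.card {i : Fin n // 0 < (hG t).eigenvalues i} ∧
          Nat.card {i : Fin n // (hG s).eigenvalues i < 0} =
            Nat.card {i : Fin n // (hG t).eigenvalues i < 0} := by
  simp only [← (hG _).exists_congr_iff_card_eigenvalues_eq (hG _)]
  constructor
  · rintro ⟨L, -, -, hunit, hL⟩ s t
    exact ⟨L s t, hunit s t, hL s t⟩
  · intro h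
    obtain ⟨o⟩ := ‹Nonempty J›
    choose T hT hGT using fun s ↦ h s o
    have hTdet (s : J) : IsUnit (T s).det := (isUnit_iff_isUnit_det _).1 (hT s)
    refine ⟨fun s t ↦ (T t)⁻¹ * T s, fun s ↦ nonsing_inv_mul _ (hTdet s), fun r s t ↦ ?_,
      fun s t ↦ (isUnit_nonsing_inv_iff.2 (hT t)).mul (hT s), fun s t ↦ ?_⟩
    · rw [Matrix.mul_assoc, mul_nonsing_inv_cancel_left _ _ (hTdet t)]
    · calc G s = (T s)ᴴ * G o * T s := hGT s
        _ = (T t * ((T t)⁻¹ * T s))ᴴ * G o * (T t * ((T t)⁻¹ * T s)) := by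
          rw [mul_nonsing_inv_cancel_left _ _ (hTdet t)]
        _ = ((T t)⁻¹ * T s)ᴴ * ((T t)ᴴ * G o * T t) * ((T t)⁻¹ * T s) := by
          simp only [conjTranspose_mul (T t), Matrix.mul_assoc]
        _ = _ := by rw [← hGT t]
end

section
/- Let J be a nonempty index set, n a natural number, and G : J → Matrix n n ℝ a family of symmetric real matrices (possibly singular). There exists a family of invertible matrices L : J → J → Matrix n n ℝ satisfying L(s,s) = 1, L(t,r) * L(s,t) = L(s,r) for all r,s,t ∈ J, and G(s) = (L(s,t))ᵀ * G(t) * L(s,t) for all s,t ∈ J, if and only if both the number of positive eigenvalues and the number of negative eigenvalues of G(s) (counted with multiplicity) are independent of s ∈ J. -/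
open Matrix

namespace Matrix

variable {ι R : Type*} [Fintype ι] [DecidableEq ι] [CommRing R]

lemma toQuadraticForm'_apply (A : Matrix ι ι R) (x : ι → R) :
    A.toQuadraticForm' x = x ⬝ᵥ A *ᵥ x := by
  simp [toQuadraticForm', toLinearMap₂'_apply']

lemma toMatrix'_toQuadraticForm' [Invertible (2 : R)] {A : Matrix ι ι R} (hA : A.IsSymm) :
    A.toQuadraticForm'.toMatrix' = A := by
  have h (x y : ι → R) : toLinearMap₂' R A x y = toLinearMap₂' R A y x := by
    simp only [toLinearMap₂'_apply']
    rw [dotProduct_mulVec, dotProduct_comm, ← mulVec_transpose, hA.eq]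
  rw [QuadraticForm.toMatrix', toQuadraticForm', QuadraticMap.associated_left_inverse R h]
  exact LinearMap.toMatrix'_toLinearMap₂' A

lemma toQuadraticForm'_transpose_mul_mul (A P : Matrix ι ι R) (x : ι → R) :
    (Pᵀ * A * P).toQuadraticForm' x = A.toQuadraticForm' (P *ᵥ x) := by
  rw [toQuadraticForm'_apply, toQuadraticForm'_apply, ← mulVec_mulVec, ← mulVec_mulVec,
    dotProduct_mulVec, vecMul_transpose]

/-- Congruent matrices define equivalent quadratic forms. -/
lemma toQuadraticForm'_equivalent_of_eq {A B P : Matrix ι ι R} (hP : IsUnit P)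
    (h : A = Pᵀ * B * P) : A.toQuadraticForm'.Equivalent B.toQuadraticForm' :=
  ⟨{ P.toLinearEquiv' hP.invertible with
      map_app' := fun x ↦ by
        rw [h, toQuadraticForm'_transpose_mul_mul]
        rfl }⟩

/-- Symmetric matrices defining equivalent quadratic forms are congruent. -/
lemma exists_isUnit_eq_transpose_mul_mul [Invertible (2 : R)] {A B : Matrix ι ι R}
    (hA : A.IsSymm) (hB : B.IsSymm)
    (h : A.toQuadraticForm'.Equivalent B.toQuadraticForm') :
    ∃ P : Matrix ι ι R, IsUnit P ∧ A = Pᵀ * B * P := by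
  obtain ⟨e⟩ := h
  refine ⟨LinearMap.toMatrix' (e.toLinearEquiv : (ι → R) →ₗ[R] ι → R), ?_, ?_⟩
  · refine .of_mul_eq_one (LinearMap.toMatrix' (e.toLinearEquiv.symm : (ι → R) →ₗ[R] ι → R)) ?_
    rw [← LinearMap.toMatrix'_comp, ← LinearEquiv.coe_trans, LinearEquiv.symm_trans_self,
      LinearEquiv.refl_toLinearMap, LinearMap.toMatrix'_id]
  · have hcomp : B.toQuadraticForm'.comp (e.toLinearEquiv : (ι → R) →ₗ[R] ι → R) =
        A.toQuadraticForm' := by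
      ext x
      exact e.map_app x
    have := congrArg QuadraticForm.toMatrix' hcomp
    rwa [QuadraticForm.toMatrix'_comp, toMatrix'_toQuadraticForm' hA,
      toMatrix'_toQuadraticForm' hB, eq_comm] at this

lemma toQuadraticForm'_diagonal (w : ι → R) :
    (diagonal w).toQuadraticForm' = QuadraticMap.weightedSumSquares R w := by
  ext x
  simp [toQuadraticForm'_apply, dotProduct, mulVec_diagonal, mul_left_comm]

end Matrix

lemma Matrix.IsHermitian.toQuadraticForm'_equivalent_weightedSumSquares {ι : Type*} [Fintype ι]
    [DecidableEq ι] {A : Matrix ι ι ℝ} (hA : A.IsHermitian) :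
    A.toQuadraticForm'.Equivalent (QuadraticMap.weightedSumSquares ℝ hA.eigenvalues) := by
  rw [← toQuadraticForm'_diagonal]
  refine toQuadraticForm'_equivalent_of_eq (P := star (hA.eigenvectorUnitary : Matrix ι ι ℝ))
    (Unitary.toUnits (star hA.eigenvectorUnitary)).isUnit ?_
  conv_lhs => rw [hA.spectral_theorem, Unitary.conjStarAlgAut_apply]
  simp [star_eq_conjTranspose]

lemma exists_perm_sign_comp_eq {ι R : Type*} [Finite ι] [Zero R] [LinearOrder R] {w w' : ι → R}
    (hpos : Nat.card {i // 0 < w i} = Nat.card {i // 0 < w' i})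
    (hneg : Nat.card {i // w i < 0} = Nat.card {i // w' i < 0}) :
    ∃ σ : Equiv.Perm ι, ∀ i, SignType.sign (w' (σ i)) = SignType.sign (w i) := by
  classical
  have := Fintype.ofFinite ι
  have hcard (v : ι → R) : Nat.card {i // v i = 0} + Nat.card {i // 0 < v i} +
      Nat.card {i // v i < 0} = Nat.card ι := by
    simp only [Nat.card_eq_fintype_card, Fintype.card_subtype]
    rw [← Finset.card_union_of_disjoint, ← Finset.card_union_of_disjoint, ← Finset.card_univ]
    · congr 1
      ext i
      have := lt_trichotomy (v i) 0
      simp; tauto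
    all_goals
      rw [Finset.disjoint_left]
      grind
  have hzero : Nat.card {i // w i = 0} = Nat.card {i // w' i = 0} := by
    have := hcard w
    have := hcard w'
    lia
  have hfib (c : SignType) : Nonempty
      ({i // SignType.sign (w i) = c} ≃ {i // SignType.sign (w' i) = c}) := by
    refine Finite.card_eq.1 ?_
    cases c
    · simpa using hzero
    · simpa [sign_eq_neg_one_iff] using hneg
    · simpa [sign_eq_one_iff] using hpos
  exact ⟨Equiv.ofFiberEquiv fun c ↦ (hfib c).some,
    Equiv.ofFiberEquiv_map (g := fun i ↦ SignType.sign (w' i)) _⟩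

lemma QuadraticMap.weightedSumSquares_comp_equivalent {ι ι' R : Type*} [Fintype ι] [Fintype ι']
    [CommRing R] (w : ι' → R) (σ : ι ≃ ι') :
    (weightedSumSquares R (w ∘ σ)).Equivalent (weightedSumSquares R w) :=
  ⟨{ LinearEquiv.funCongrLeft R R σ.symm with
      map_app' := fun x ↦ by
        simpa [LinearEquiv.funCongrLeft, LinearMap.funLeft] using
          (Equiv.sum_comp σ fun i ↦ w i * (x (σ.symm i) * x (σ.symm i))).symm }⟩

/-- Existence part of **Sylvester's law of inertia** for diagonal forms: real weighted sums of
squares with equally many positive and equally many negative weights are equivalent. -/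
lemma QuadraticForm.weightedSumSquares_equivalent_of_card_eq {ι : Type*} [Fintype ι]
    {w w' : ι → ℝ} (hpos : Nat.card {i // 0 < w i} = Nat.card {i // 0 < w' i})
    (hneg : Nat.card {i // w i < 0} = Nat.card {i // w' i < 0}) :
    (QuadraticMap.weightedSumSquares ℝ w).Equivalent (QuadraticMap.weightedSumSquares ℝ w') := by
  obtain ⟨σ, hσ⟩ := exists_perm_sign_comp_eq hpos hneg
  refine .trans ⟨isometryEquivSignWeightedSumSquares w⟩ <|
    .trans ?_ (QuadraticMap.Equivalent.symm ⟨isometryEquivSignWeightedSumSquares w'⟩)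
  have hcomp : (fun i ↦ (SignType.sign (w i) : ℝ)) = (fun i ↦ (SignType.sign (w' i) : ℝ)) ∘ σ := by
    ext i
    simp [hσ]
  rw [hcomp]
  exact QuadraticMap.weightedSumSquares_comp_equivalent _ σ

/-- **Sylvester's law of inertia** in terms of eigenvalues. -/
lemma Matrix.IsHermitian.exists_congruent_iff_card_eigenvalues_eq {ι : Type*} [Fintype ι]
    [DecidableEq ι] {A B : Matrix ι ι ℝ} (hA : A.IsHermitian) (hB : B.IsHermitian) :
    (∃ P : Matrix ι ι ℝ, IsUnit P ∧ A = Pᵀ * B * P) ↔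
      Nat.card {i // 0 < hA.eigenvalues i} = Nat.card {i // 0 < hB.eigenvalues i} ∧
        Nat.card {i // hA.eigenvalues i < 0} = Nat.card {i // hB.eigenvalues i < 0} := by
  have hQA := hA.toQuadraticForm'_equivalent_weightedSumSquares
  have hQB := hB.toQuadraticForm'_equivalent_weightedSumSquares
  constructor
  · rintro ⟨P, hP, h⟩
    have hAB := toQuadraticForm'_equivalent_of_eq hP h
    exact ⟨(QuadraticForm.sigPos_of_equiv_weightedSumSquares hQA).symm.trans <|
        hAB.sigPos_eq.trans (QuadraticForm.sigPos_of_equiv_weightedSumSquares hQB),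
      (QuadraticForm.sigNeg_of_equiv_weightedSumSquares hQA).symm.trans <|
        hAB.sigNeg_eq.trans (QuadraticForm.sigNeg_of_equiv_weightedSumSquares hQB)⟩
  · rintro ⟨hpos, hneg⟩
    exact exists_isUnit_eq_transpose_mul_mul hA hB <|
      (hQA.trans (QuadraticForm.weightedSumSquares_equivalent_of_card_eq hpos hneg)).trans hQB.symm

/-- For a family of symmetric (possibly singular) real matrices `G s`,
an invertible transport family `L` compatible with `G` exists iff the numbers of positive
and of negative eigenvalues of `G s` (with multiplicity) are independent of `s`.
(Over `ℝ`, `Matrix.IsHermitian` means exactly that the matrix is symmetric.) -/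
theorem compatible_transport_exists_iff_inertia_constant_real
    {J : Type*} [Nonempty J] {n : ℕ}
    (G : J → Matrix (Fin n) (Fin n) ℝ)
    (hG : ∀ s, (G s).IsHermitian) :
    (∃ L : J → J → Matrix (Fin n) (Fin n) ℝ,
        (∀ s, L s s = 1) ∧
        (∀ r s t, L t r * L s t = L s r) ∧
        (∀ s t, IsUnit (L s t)) ∧
        (∀ s t, G s = (L s t)ᵀ * G t * L s t)) ↔
      ∀ s t : J,
        Nat.card {i : Fin n // 0 < (hG s).eigenvalues i} =
            Nat.card {i : Fin n // 0 < (hG t).eigenvalues i} ∧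
          Nat.card {i : Fin n // (hG s).eigenvalues i < 0} =
            Nat.card {i : Fin n // (hG t).eigenvalues i < 0} := by
  constructor
  · rintro ⟨L, -, -, hL, hLG⟩ s t
    exact ((hG s).exists_congruent_iff_card_eigenvalues_eq (hG t)).1 ⟨L s t, hL s t, hLG s t⟩
  · intro h
    obtain ⟨o⟩ := ‹Nonempty J›
    choose P hP hPG using fun s ↦
      ((hG s).exists_congruent_iff_card_eigenvalues_eq (hG o)).2 (h s o)
    have hdet (s : J) : IsUnit (P s).det := (isUnit_iff_isUnit_det _).1 (hP s)
    refine ⟨fun s t ↦ (P t)⁻¹ * P s, fun s ↦ nonsing_inv_mul _ (hdet s), fun r s t ↦ ?_,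
      fun s t ↦ ((isUnit_nonsing_inv_iff).2 (hP t)).mul (hP s), fun s t ↦ ?_⟩
    · rw [Matrix.mul_assoc, mul_nonsing_inv_cancel_left _ _ (hdet t)]
    · have hPL : P t * ((P t)⁻¹ * P s) = P s := mul_nonsing_inv_cancel_left _ _ (hdet t)
      calc G s = (P t * ((P t)⁻¹ * P s))ᵀ * G o * (P t * ((P t)⁻¹ * P s)) := by rw [hPL, hPG s]
        _ = ((P t)⁻¹ * P s)ᵀ * G t * ((P t)⁻¹ * P s) := by
          rw [hPG t, transpose_mul (P t)]
          simp only [Matrix.mul_assoc]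
end

section
/- Let J be a nonempty index set, n a natural number, G : J → Matrix n n ℝ a family of symmetric real matrices, G₀ a fixed real n×n matrix, and D : J → Matrix n n ℝ a family of invertible matrices with (D(s))ᵀ * G(s) * D(s) = G₀ for all s ∈ J. Let F : J → Matrix n n ℝ be a family of invertible matrices and define L(s,t) := (F(t))⁻¹ * F(s). Then the compatibility condition G(s) = (L(s,t))ᵀ * G(t) * L(s,t) holds for all s,t ∈ J if and only if there exist an invertible real n×n matrix B and a family Z : J → Matrix n n ℝ of invertible matrices satisfying (Z(s))ᵀ * G₀ * Z(s) = G₀ for all s ∈ J and F(s) = B * Z(s) * (D(s))⁻¹ for all s ∈ J. -/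
open Matrix

/-- Matrix congruence by an invertible matrix is inverted by congruence by its inverse. -/
theorem Matrix.congruence_inv {m R : Type*} [Fintype m] [DecidableEq m] [CommRing R]
    {Q A C : Matrix m m R} (hQ : IsUnit Q) (h : Qᵀ * A * Q = C) :
    (Q⁻¹)ᵀ * C * Q⁻¹ = A := by
  have hdet : IsUnit Q.det := (Matrix.isUnit_iff_isUnit_det Q).1 hQ
  have hT : (Q⁻¹)ᵀ * Qᵀ = 1 := by
    rw [← transpose_mul, Matrix.mul_nonsing_inv Q hdet, transpose_one]
  calc (Q⁻¹)ᵀ * C * Q⁻¹ = ((Q⁻¹)ᵀ * Qᵀ) * A * (Q * Q⁻¹) := by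
        rw [← h]; simp only [Matrix.mul_assoc]
    _ = A := by rw [hT, Matrix.mul_nonsing_inv Q hdet, Matrix.one_mul, Matrix.mul_one]

/-- Congruence by a product is iterated congruence. -/
theorem Matrix.congruence_mul {m R : Type*} [Fintype m] [CommRing R]
    (P Q A : Matrix m m R) : (P * Q)ᵀ * A * (P * Q) = Qᵀ * (Pᵀ * A * P) * Q := by
  simp only [transpose_mul, Matrix.mul_assoc]

/-- Proposition 3.1: with `D` a congruence diagonalization of the metric `G`
(`Dᵀ G D = G₀`), the transport `L s t = (F t)⁻¹ * F s` is compatible with `G` iff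
`F s = B * Z s * (D s)⁻¹` for a fixed invertible `B` and semi-pseudo-orthogonal matrices
`Z s` (i.e. `(Z s)ᵀ * G₀ * Z s = G₀`). -/
theorem compatible_transports_description
    {J : Type*} [Nonempty J] {n : ℕ}
    (G : J → Matrix (Fin n) (Fin n) ℝ)
    (hGsymm : ∀ s, (G s).IsSymm)
    (G₀ : Matrix (Fin n) (Fin n) ℝ)
    (D : J → Matrix (Fin n) (Fin n) ℝ)
    (hD : ∀ s, IsUnit (D s))
    (hDG : ∀ s, (D s)ᵀ * G s * D s = G₀)
    (F : J → Matrix (Fin n) (Fin n) ℝ)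
    (hF : ∀ s, IsUnit (F s))
    (L : J → J → Matrix (Fin n) (Fin n) ℝ)
    (hL : ∀ s t, L s t = (F t)⁻¹ * F s) :
    (∀ s t, G s = (L s t)ᵀ * G t * L s t) ↔
      ∃ B : Matrix (Fin n) (Fin n) ℝ, IsUnit B ∧
        ∃ Z : J → Matrix (Fin n) (Fin n) ℝ,
          (∀ s, IsUnit (Z s)) ∧
          (∀ s, (Z s)ᵀ * G₀ * Z s = G₀) ∧
          (∀ s, F s = B * Z s * (D s)⁻¹) := by
  have hinv : ∀ {M : Matrix (Fin n) (Fin n) ℝ}, IsUnit M → IsUnit M⁻¹ :=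
    fun h => Matrix.isUnit_nonsing_inv_iff.2 h
  have hdet : ∀ {M : Matrix (Fin n) (Fin n) ℝ}, IsUnit M → IsUnit M.det :=
    fun {M} h => (Matrix.isUnit_iff_isUnit_det M).1 h
  constructor
  · intro h
    obtain ⟨s₀⟩ := ‹Nonempty J›
    refine ⟨F s₀ * D s₀, (hF s₀).mul (hD s₀),
      fun s => (D s₀)⁻¹ * ((F s₀)⁻¹ * F s) * D s, fun s => ?_, fun s => ?_, fun s => ?_⟩
    · exact ((hinv (hD s₀)).mul ((hinv (hF s₀)).mul (hF s))).mul (hD s)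
    · rw [Matrix.congruence_mul, Matrix.congruence_mul,
        Matrix.congruence_inv (hD s₀) (hDG s₀), ← hL, ← h, hDG]
    · simp only [Matrix.mul_assoc]
      rw [Matrix.mul_nonsing_inv _ (hdet (hD s)), Matrix.mul_one,
        Matrix.mul_nonsing_inv_cancel_left _ _ (hdet (hD s₀)),
        Matrix.mul_nonsing_inv_cancel_left _ _ (hdet (hF s₀))]
  · rintro ⟨B, hB, Z, -, hZG, hFZ⟩ s t
    have hG : ∀ r, (B⁻¹ * F r)ᵀ * G₀ * (B⁻¹ * F r) = G r := fun r => by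
      rw [hFZ, Matrix.mul_assoc B, Matrix.nonsing_inv_mul_cancel_left _ _ (hdet hB),
        Matrix.congruence_mul, hZG, Matrix.congruence_inv (hD r) (hDG r)]
    rw [hL, ← hG t, ← Matrix.congruence_mul, Matrix.mul_assoc B⁻¹,
      Matrix.mul_nonsing_inv_cancel_left _ _ (hdet (hF t)), hG]
end

section
/- Let J be an index set, n a natural number, G : J → Matrix n n ℝ a family of symmetric real matrices, G₀ a fixed real n×n matrix, and D : J → Matrix n n ℝ a family of invertible matrices with (D(s))ᵀ * G(s) * D(s) = G₀ for all s ∈ J. Define L(s,t) := D(t) * (D(s))⁻¹ for s,t ∈ J. Then L satisfies L(s,s) = 1 and L(t,r) * L(s,t) = L(s,r) for all r,s,t ∈ J, each L(s,t) is invertible, and G(s) = (L(s,t))ᵀ * G(t) * L(s,t) for all s,t ∈ J. -/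
open Matrix

/-- If `(D s)ᵀ * G s * D s = G₀` for all `s` with `D s` invertible, then
`L s t := D t * (D s)⁻¹` is an invertible transport family compatible with `G`. -/
theorem explicit_compatible_transport
    {J : Type*} {n : ℕ}
    (G : J → Matrix (Fin n) (Fin n) ℝ)
    (hGsymm : ∀ s, (G s).IsSymm)
    (G₀ : Matrix (Fin n) (Fin n) ℝ)
    (D : J → Matrix (Fin n) (Fin n) ℝ)
    (hD : ∀ s, IsUnit (D s))
    (hDG : ∀ s, (D s)ᵀ * G s * D s = G₀)
    (L : J → J → Matrix (Fin n) (Fin n) ℝ)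
    (hL : ∀ s t, L s t = D t * (D s)⁻¹) :
    (∀ s, L s s = 1) ∧
    (∀ r s t, L t r * L s t = L s r) ∧
    (∀ s t, IsUnit (L s t)) ∧
    (∀ s t, G s = (L s t)ᵀ * G t * L s t) := by
  have hdet s : IsUnit (D s).det := (isUnit_iff_isUnit_det _).1 (hD s)
  have hright s : D s * (D s)⁻¹ = 1 := mul_nonsing_inv _ (hdet s)
  have hleft s : (D s)⁻¹ * D s = 1 := nonsing_inv_mul _ (hdet s)
  refine ⟨fun s => by rw [hL, hright], fun r s t => ?_, fun s t => ?_, fun s t => ?_⟩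
  · calc
      L t r * L s t = D r * ((D t)⁻¹ * D t) * (D s)⁻¹ := by simp only [hL, Matrix.mul_assoc]
      _ = L s r := by rw [hleft, Matrix.mul_one, hL]
  · rw [hL]
    exact (hD t).mul (isUnit_nonsing_inv_iff.2 (hD s))
  · symm
    calc
      (L s t)ᵀ * G t * L s t = ((D s)⁻¹)ᵀ * ((D t)ᵀ * G t * D t) * (D s)⁻¹ := by
        simp only [hL, transpose_mul, Matrix.mul_assoc]
      _ = ((D s)⁻¹)ᵀ * ((D s)ᵀ * G s * D s) * (D s)⁻¹ := by rw [hDG, hDG]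
      _ = (D s * (D s)⁻¹)ᵀ * G s * (D s * (D s)⁻¹) := by
        simp only [transpose_mul, Matrix.mul_assoc]
      _ = G s := by rw [hright, transpose_one, Matrix.one_mul, Matrix.mul_one]
end
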